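/- Let G be a graph with n vertices, and let G' be the graph obtained from G by adding n² new isolated vertices. Then for every natural number k, the following are equivalent: (i) there exists a set F of at most k unordered pairs of non-adjacent vertices of G such that G + F is a proper interval graph; (ii) there exists a set F' of at most k unordered pairs of non-adjacent vertices of G' such that G' + F' is a proper Helly circular-arc graph. -/

import Mathlib

/-! Common definitions: arc/interval representations, graph classes,
induced subgraph containment, small named graphs, reduced graphs. -/

/-- The point of the unit circle corresponding to parameter `t`. -/
noncomputable def circlePt (t : ℝ) : ℝ × ℝ :=
  (Real.cos (2 * Real.pi * t), Real.sin (2 * Real.pi * t))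

/-- A (nonempty closed) arc of the unit circle: the image under
`t ↦ (cos 2πt, sin 2πt)` of a closed interval `[a, b] ⊆ ℝ` with `0 ≤ b - a < 1`. -/
def IsUnitCircleArc (A : Set (ℝ × ℝ)) : Prop :=
  ∃ a b : ℝ, 0 ≤ b - a ∧ b - a < 1 ∧ A = circlePt '' Set.Icc a b

/-- An arc representation of a graph: each vertex gets an arc of the unit circle,
and two distinct vertices are adjacent iff their arcs intersect. -/
def IsArcRep {V : Type*} (G : SimpleGraph V) (f : V → Set (ℝ × ℝ)) : Prop :=
  (∀ v, IsUnitCircleArc (f v)) ∧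
    ∀ u v : V, u ≠ v → (G.Adj u v ↔ (f u ∩ f v).Nonempty)

/-- A family of sets is proper if no member is properly contained in another. -/
def ProperFamily {V α : Type*} (f : V → Set α) : Prop :=
  ∀ u v : V, ¬ f u ⊂ f v

/-- A family of sets is Helly if every subfamily of pairwise intersecting sets
has a common point. -/
def HellyFamily {V α : Type*} (f : V → Set α) : Prop :=
  ∀ S : Set V, (∀ u ∈ S, ∀ v ∈ S, (f u ∩ f v).Nonempty) → (⋂ v ∈ S, f v).Nonempty

/-- A proper circular-arc graph: admits an arc representation with no arc
properly contained in another. -/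
def IsProperCircularArcGraph {V : Type*} (G : SimpleGraph V) : Prop :=
  ∃ f : V → Set (ℝ × ℝ), IsArcRep G f ∧ ProperFamily f

/-- A proper Helly circular-arc graph: admits an arc representation that is
simultaneously proper and Helly. -/
def IsProperHellyCircularArcGraph {V : Type*} (G : SimpleGraph V) : Prop :=
  ∃ f : V → Set (ℝ × ℝ), IsArcRep G f ∧ ProperFamily f ∧ HellyFamily f

/-- An interval representation: each vertex gets a nonempty closed bounded
interval of ℝ; distinct vertices adjacent iff intervals intersect. -/
def IsIntervalRep {V : Type*} (G : SimpleGraph V) (f : V → Set ℝ) : Prop :=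
  (∀ v, ∃ a b : ℝ, a ≤ b ∧ f v = Set.Icc a b) ∧
    ∀ u v : V, u ≠ v → (G.Adj u v ↔ (f u ∩ f v).Nonempty)

def IsIntervalGraph {V : Type*} (G : SimpleGraph V) : Prop :=
  ∃ f : V → Set ℝ, IsIntervalRep G f

def IsProperIntervalGraph {V : Type*} (G : SimpleGraph V) : Prop :=
  ∃ f : V → Set ℝ, IsIntervalRep G f ∧ ProperFamily f

/-- A graph is bipartite: its vertices can be partitioned into two independent sets. -/
def IsBipartite {V : Type*} (G : SimpleGraph V) : Prop :=
  ∃ c : V → Bool, ∀ u v : V, G.Adj u v → c u ≠ c v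

/-- A permutation graph. -/
def IsPermutationGraph {V : Type*} (G : SimpleGraph V) : Prop :=
  ∃ a b : V → ℝ, Function.Injective a ∧ Function.Injective b ∧
    ∀ u v : V, u ≠ v → (G.Adj u v ↔ (a u - a v) * (b u - b v) < 0)

def IsBipartitePermutationGraph {V : Type*} (G : SimpleGraph V) : Prop :=
  IsPermutationGraph G ∧ IsBipartite G

/-- `f : ZMod ℓ → V` is an induced (chordless) cycle of length `ℓ ≥ 3` in `G`:
`f` is injective and two images are adjacent iff their indices are consecutive mod `ℓ`. -/
def IsInducedCycle {V : Type*} (G : SimpleGraph V) (ℓ : ℕ) (f : ZMod ℓ → V) : Prop :=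
  3 ≤ ℓ ∧ Function.Injective f ∧
    ∀ i j : ZMod ℓ, G.Adj (f i) (f j) ↔ (i = j + 1 ∨ j = i + 1)

/-- `G` contains `H` as an induced subgraph. -/
def ContainsInduced {V W : Type*} (G : SimpleGraph V) (H : SimpleGraph W) : Prop :=
  ∃ f : W → V, Function.Injective f ∧ ∀ u v : W, H.Adj u v ↔ G.Adj (f u) (f v)

/-- `G` contains `C_ℓ*`: an induced cycle of length `ℓ` together with a vertex
adjacent to no vertex of the cycle. -/
def HasCycleStar {V : Type*} (G : SimpleGraph V) (ℓ : ℕ) : Prop :=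
  ∃ (f : ZMod ℓ → V) (v : V), IsInducedCycle G ℓ f ∧ ∀ i : ZMod ℓ, ¬ G.Adj v (f i)

/-- A maximal clique. -/
def IsMaxClique {V : Type*} (G : SimpleGraph V) (s : Set V) : Prop :=
  G.IsClique s ∧ ∀ t : Set V, G.IsClique t → s ⊆ t → t = s

/-- A clique path: a linear arrangement of all maximal cliques of `G` such that
the cliques containing any fixed vertex are consecutive. -/
def IsCliquePath {W : Type*} (G : SimpleGraph W) (q : ℕ) (K : Fin q → Set W) : Prop :=
  Function.Injective K ∧ (∀ i, IsMaxClique G (K i)) ∧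
    (∀ s : Set W, IsMaxClique G s → ∃ i, K i = s) ∧
    ∀ (v : W) (i j k : Fin q), i ≤ j → j ≤ k → v ∈ K i → v ∈ K k → v ∈ K j

/-- A circular interval of residues mod `n`: `{p, p+1, …, p+m}`. -/
def IsCircInterval {n : ℕ} (s : Set (ZMod n)) : Prop :=
  ∃ (p : ZMod n) (m : ℕ), s = {x : ZMod n | ∃ k : ℕ, k ≤ m ∧ x = p + (k : ZMod n)}

/-! ### Small named graphs -/

/-- The claw `K_{1,3}`. -/
def clawG : SimpleGraph (Fin 4) := SimpleGraph.fromRel (fun u _ => u = 0)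

/-- The net: a triangle `{0,1,2}` with pendant vertices `3,4,5` attached to
`0,1,2` respectively. -/
def netG : SimpleGraph (Fin 6) :=
  SimpleGraph.fromRel (fun u v => (u.val < 3 ∧ v.val < 3) ∨ v.val = u.val + 3)

/-- The tent `S_3`: triangle `{0,1,2}`, independent set `{3,4,5}`, with
`3 ~ 0,1`, `4 ~ 1,2`, `5 ~ 2,0`. -/
def tentS3 : SimpleGraph (Fin 6) :=
  SimpleGraph.fromRel (fun u v =>
    (u.val < 3 ∧ v.val < 3) ∨ (u = 3 ∧ (v = 0 ∨ v = 1)) ∨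
      (u = 4 ∧ (v = 1 ∨ v = 2)) ∨ (u = 5 ∧ (v = 2 ∨ v = 0)))

/-- `S_3*`: the tent together with an isolated vertex `6`. -/
def S3star : SimpleGraph (Fin 7) :=
  SimpleGraph.fromRel (fun u v =>
    (u.val < 3 ∧ v.val < 3) ∨ (u = 3 ∧ (v = 0 ∨ v = 1)) ∨
      (u = 4 ∧ (v = 1 ∨ v = 2)) ∨ (u = 5 ∧ (v = 2 ∨ v = 0)))

/-- The complement of `S_3*`. -/
def compS3star : SimpleGraph (Fin 7) := S3starᶜ

/-- The complement of `C_4*`: two edges `0-2`, `1-3` plus a universal vertex `4`. -/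
def compC4star : SimpleGraph (Fin 5) :=
  SimpleGraph.fromRel (fun u v => (u = 0 ∧ v = 2) ∨ (u = 1 ∧ v = 3) ∨ u = 4)

/-- The chordless cycle `C_6`. -/
def cycle6G : SimpleGraph (Fin 6) :=
  SimpleGraph.fromRel (fun u v => v.val = (u.val + 1) % 6)

/-- The complement of `C_6`. -/
def compC6 : SimpleGraph (Fin 6) := cycle6Gᶜ

/-- The wheel `W_4`: a `C_4` on `{0,1,2,3}` plus a hub `4`. -/
def W4G : SimpleGraph (Fin 5) :=
  SimpleGraph.fromRel (fun u v => (u.val < 4 ∧ v.val = (u.val + 1) % 4) ∨ v = 4)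

/-- The wheel `W_5`: a `C_5` on `{0,…,4}` plus a hub `5`. -/
def W5G : SimpleGraph (Fin 6) :=
  SimpleGraph.fromRel (fun u v => (u.val < 5 ∧ v.val = (u.val + 1) % 5) ∨ v = 5)

/-- `F_1` (the long claw): the claw with each edge subdivided once. -/
def F1G : SimpleGraph (Fin 7) :=
  SimpleGraph.fromRel (fun u v =>
    (u = 0 ∧ v = 1) ∨ (u = 1 ∧ v = 2) ∨ (u = 0 ∧ v = 3) ∨ (u = 3 ∧ v = 4) ∨
      (u = 0 ∧ v = 5) ∨ (u = 5 ∧ v = 6))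

/-- `F_2`: a `C_4` `0-1-2-3-0` with pendant vertices `4,5,6` attached to `0,2,3`. -/
def F2G : SimpleGraph (Fin 7) :=
  SimpleGraph.fromRel (fun u v =>
    (u = 0 ∧ v = 1) ∨ (u = 1 ∧ v = 2) ∨ (u = 2 ∧ v = 3) ∨ (u = 3 ∧ v = 0) ∨
      (u = 0 ∧ v = 4) ∨ (u = 2 ∧ v = 5) ∨ (u = 3 ∧ v = 6))

/-- `F_3`: a `C_6` `0-1-2-3-4-5-0` with chord `0-3` and pendant `6` at `0`. -/
def F3G : SimpleGraph (Fin 7) :=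
  SimpleGraph.fromRel (fun u v =>
    (u.val < 6 ∧ v.val = (u.val + 1) % 6) ∨ (u = 0 ∧ v = 3) ∨ (u = 0 ∧ v = 6))

/-- `F_4`: a `C_6` `0-1-2-3-4-5-0` with chord `0-3` and a vertex `6` adjacent
exactly to `0` and `3`. -/
def F4G : SimpleGraph (Fin 7) :=
  SimpleGraph.fromRel (fun u v =>
    (u.val < 6 ∧ v.val = (u.val + 1) % 6) ∨ (u = 0 ∧ v = 3) ∨ (u = 6 ∧ (v = 0 ∨ v = 3)))

/-- A reduced graph: connected, co-connected, and containing none of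
`C_3*`, `C_5*`, the complement of `C_4*`, `C_6`, `S_3`, the complement of `S_3*`,
`F_1`, `F_2`, `F_3`, `F_4` as induced subgraphs. -/
def IsReducedGraph {V : Type*} (R : SimpleGraph V) : Prop :=
  R.Connected ∧ Rᶜ.Connected ∧
    ¬ HasCycleStar R 3 ∧ ¬ HasCycleStar R 5 ∧
    ¬ ContainsInduced R compC4star ∧
    ¬ (∃ f : ZMod 6 → V, IsInducedCycle R 6 f) ∧
    ¬ ContainsInduced R tentS3 ∧
    ¬ ContainsInduced R compS3star ∧
    ¬ ContainsInduced R F1G ∧ ¬ ContainsInduced R F2G ∧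
    ¬ ContainsInduced R F3G ∧ ¬ ContainsInduced R F4G

theorem circlePt_eq_iff {s t : ℝ} : circlePt s = circlePt t ↔ ∃ n : ℤ, s = t + n := by
  constructor
  · intro h
    have hc : Real.cos (2 * Real.pi * s) = Real.cos (2 * Real.pi * t) := congrArg Prod.fst h
    have hs : Real.sin (2 * Real.pi * s) = Real.sin (2 * Real.pi * t) := congrArg Prod.snd h
    obtain ⟨n, hn⟩ := Real.Angle.angle_eq_iff_two_pi_dvd_sub.1 (Real.Angle.cos_sin_inj hc hs)
    refine ⟨n, mul_left_cancel₀ Real.two_pi_pos.ne' ?_⟩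
    linarith
  · rintro ⟨n, rfl⟩
    have e : 2 * Real.pi * (t + n) = 2 * Real.pi * t + n * (2 * Real.pi) := by ring
    simp [circlePt, e, Real.cos_add_int_mul_two_pi, Real.sin_add_int_mul_two_pi]

theorem circlePt_add_int (t : ℝ) (n : ℤ) : circlePt (t + n) = circlePt t :=
  circlePt_eq_iff.2 ⟨n, rfl⟩

theorem circlePt_injOn (t : ℝ) : Set.InjOn circlePt (Set.Ioo t (t + 1)) := by
  rintro x ⟨hx, hx'⟩ y ⟨hy, hy'⟩ h
  obtain ⟨n, hn⟩ := circlePt_eq_iff.1 h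
  have h1 : (n : ℝ) < 1 := by linarith
  have h2 : (-1 : ℝ) < n := by linarith
  have h3 : n < 1 := by exact_mod_cast h1
  have h4 : -1 < n := by exact_mod_cast h2
  obtain rfl : n = 0 := by omega
  simpa using hn

/-- An arc missing the point with parameter `t` lifts to an interval inside `(t, t + 1)`. -/
theorem IsUnitCircleArc.exists_lift {A : Set (ℝ × ℝ)} (hA : IsUnitCircleArc A) {t : ℝ}
    (ht : circlePt t ∉ A) :
    ∃ a b : ℝ, a ≤ b ∧ t < a ∧ b < t + 1 ∧ A = circlePt '' Set.Icc a b := by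
  obtain ⟨a, b, hab, -, rfl⟩ := hA
  set n : ℤ := ⌊a - t⌋
  have h1 : (n : ℝ) ≤ a - t := Int.floor_le _
  have h2 : a - t < n + 1 := Int.lt_floor_add_one _
  have hmiss : ∀ m : ℤ, t + m ∉ Set.Icc a b := fun m hm =>
    ht ⟨t + m, hm, circlePt_add_int t m⟩
  refine ⟨a - n, b - n, by linarith, ?_, ?_, ?_⟩
  · by_contra! h
    exact hmiss n ⟨by linarith, by linarith⟩
  · by_contra! h
    exact hmiss (n + 1) ⟨by push_cast; linarith, by push_cast; linarith⟩
  · rw [← Set.image_sub_const_Icc, Set.image_image]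
    refine Set.image_congr fun x _ => ?_
    have := circlePt_add_int (x - n) n
    rwa [sub_add_cancel] at this

/-- Cutting the circle at a point of the arc of an isolated vertex. -/
theorem IsArcRep.isProperIntervalGraph_comap {V W : Type*} {H : SimpleGraph W}
    {f : W → Set (ℝ × ℝ)} (hf : IsArcRep H f) (hp : ProperFamily f) {w : W}
    (hw : ∀ v, ¬ H.Adj w v) (e : V ↪ W) (he : ∀ v, e v ≠ w) :
    IsProperIntervalGraph (H.comap e) := by
  obtain ⟨t, ht⟩ : ∃ t, circlePt t ∈ f w := by
    obtain ⟨a, b, hab, -, h⟩ := hf.1 w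
    exact ⟨a, h ▸ Set.mem_image_of_mem _ ⟨le_rfl, by linarith⟩⟩
  have hmiss : ∀ v, circlePt t ∉ f (e v) := fun v hv =>
    hw (e v) ((hf.2 w (e v) (he v).symm).2 ⟨_, ht, hv⟩)
  choose a b hab ha hb hfab using fun v => (hf.1 (e v)).exists_lift (hmiss v)
  have hsub : ∀ v, Set.Icc (a v) (b v) ⊆ Set.Ioo t (t + 1) := fun v x hx =>
    ⟨(ha v).trans_le hx.1, hx.2.trans_lt (hb v)⟩
  refine ⟨fun v => Set.Icc (a v) (b v), ⟨fun v => ⟨a v, b v, hab v, rfl⟩, fun u v huv => ?_⟩,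
    fun u v huv => hp (e u) (e v) ?_⟩
  · rw [SimpleGraph.comap_adj, hf.2 _ _ (e.injective.ne huv), hfab, hfab,
      ← (circlePt_injOn t).image_inter (hsub u) (hsub v), Set.image_nonempty]
  · rw [hfab, hfab]
    exact ((circlePt_injOn t).image_ssubset_image_iff (hsub u) (hsub v)).2 huv

/-- One-dimensional Helly property for closed intervals. -/
theorem hellyFamily_Icc {V : Type*} (a b : V → ℝ) :
    HellyFamily fun v => Set.Icc (a v) (b v) := by
  intro S hS
  rcases S.eq_empty_or_nonempty with rfl | ⟨v₀, hv₀⟩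
  · simp
  have hle : ∀ u ∈ S, ∀ v ∈ S, a u ≤ b v := fun u hu v hv => by
    obtain ⟨x, hx, hx'⟩ := hS u hu v hv
    exact hx.1.trans hx'.2
  refine ⟨sSup (a '' S), Set.mem_iInter₂.2 fun v hv => ⟨?_, ?_⟩⟩
  · exact le_csSup ⟨b v, by rintro _ ⟨u, hu, rfl⟩; exact hle u hu v hv⟩ ⟨v, hv, rfl⟩
  · exact csSup_le ⟨_, v₀, hv₀, rfl⟩ (by rintro _ ⟨u, hu, rfl⟩; exact hle u hu v hv)

theorem HellyFamily.image {V α β : Type*} {f : V → Set α} (hf : HellyFamily f) {φ : α → β}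
    (hφ : Function.Injective φ) [Nonempty β] : HellyFamily fun v => φ '' f v := by
  intro S hS
  rcases S.eq_empty_or_nonempty with rfl | ⟨v₀, hv₀⟩
  · simp
  obtain ⟨x, hx⟩ := hf S fun u hu v hv => by
    simpa only [← Set.image_inter hφ, Set.image_nonempty] using hS u hu v hv
  exact ⟨φ x, Set.mem_iInter₂.2 fun v hv => ⟨x, Set.mem_iInter₂.1 hx v hv, rfl⟩⟩

theorem image_Icc_of_strictMono_continuous {φ : ℝ → ℝ} (hm : StrictMono φ) (hc : Continuous φ)
    {a b : ℝ} (hab : a ≤ b) : φ '' Set.Icc a b = Set.Icc (φ a) (φ b) :=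
  (hm.monotone.image_Icc_subset).antisymm (intermediate_value_Icc hab hc.continuousOn)

theorem IsProperIntervalGraph.isProperHellyCircularArcGraph {V : Type*} {H : SimpleGraph V}
    (h : IsProperIntervalGraph H) : IsProperHellyCircularArcGraph H := by
  obtain ⟨f, ⟨hf, hadj⟩, hp⟩ := h
  choose a b hab hfab using hf
  obtain ⟨φ, hm, hc, hlo, hhi⟩ : ∃ φ : ℝ → ℝ, StrictMono φ ∧ Continuous φ ∧
      (∀ x, -2 < φ x) ∧ ∀ x, φ x < 2 :=
    ⟨Real.arctan, Real.arctan_strictMono, Real.continuous_arctan,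
      fun x => by linarith [Real.neg_pi_div_two_lt_arctan x, Real.pi_lt_four],
      fun x => by linarith [Real.arctan_lt_pi_div_two x, Real.pi_lt_four]⟩
  have hm' : StrictMono fun x => φ x / 4 := fun x y hxy => by
    have := hm hxy
    simp only
    linarith
  have hc' : Continuous fun x => φ x / 4 := hc.div_const 4
  have hinj : Function.Injective (circlePt ∘ fun x => φ x / 4) := fun x y hxy =>
    hm'.injective <| circlePt_injOn (-1 / 2)
      ⟨by linarith [hlo x], by linarith [hhi x]⟩ ⟨by linarith [hlo y], by linarith [hhi y]⟩ hxy
  refine ⟨fun v => (circlePt ∘ fun x => φ x / 4) '' f v, ⟨fun v => ?_, fun u v huv => ?_⟩,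
    fun u v huv => hp u v ?_, HellyFamily.image ?_ hinj⟩
  · refine ⟨φ (a v) / 4, φ (b v) / 4, ?_, ?_, ?_⟩
    · linarith [hm.monotone (hab v)]
    · linarith [hlo (a v), hhi (b v)]
    · simp only [hfab]
      rw [Set.image_comp, image_Icc_of_strictMono_continuous hm' hc' (hab v)]
  · rw [hadj u v huv, ← Set.image_inter hinj, Set.image_nonempty]
  · exact (hinj.injOn.image_ssubset_image_iff (Set.subset_univ _) (Set.subset_univ _)).1 huv
  · rw [funext hfab]
    exact hellyFamily_Icc a b

/-- Adding finitely many isolated vertices preserves being a proper interval graph. -/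
theorem IsProperIntervalGraph.map_inl {V : Type*} [Finite V] {H : SimpleGraph V}
    (h : IsProperIntervalGraph H) (m : ℕ) :
    IsProperIntervalGraph (H.map (Function.Embedding.inl : V ↪ V ⊕ Fin m)) := by
  obtain ⟨f, ⟨hf, hadj⟩, hp⟩ := h
  choose a b hab hfab using hf
  obtain ⟨M, hM⟩ := (Set.finite_range b).bddAbove
  have hf_lt : ∀ v (i : Fin m), (M + 1 + i : ℝ) ∉ f v := fun v i hi => by
    rw [hfab] at hi
    have h1 : b v ≤ M := hM ⟨v, rfl⟩
    have h2 : (0 : ℝ) ≤ (i : ℕ) := Nat.cast_nonneg _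
    linarith [hi.2]
  refine ⟨Sum.elim f fun i => {(M + 1 + i : ℝ)}, ⟨?_, ?_⟩, ?_⟩
  · rintro (v | i)
    · exact ⟨a v, b v, hab v, hfab v⟩
    · exact ⟨_, _, le_rfl, (Set.Icc_self _).symm⟩
  · rintro (u | i) (v | j) huv
    · simpa [SimpleGraph.map_adj] using hadj u v (by simpa using huv)
    · simpa [SimpleGraph.map_adj] using hf_lt u j
    · simpa [SimpleGraph.map_adj] using hf_lt v i
    · have hij : i ≠ j := by simpa using huv
      simpa [SimpleGraph.map_adj, Fin.ext_iff] using fun h => hij (Fin.ext h.symm)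
  · rintro (u | i) (v | j) huv
    · exact hp u v huv
    · have hne : (f u).Nonempty := hfab u ▸ Set.nonempty_Icc.2 (hab u)
      exact hne.ne_empty (Set.ssubset_singleton_iff.1 huv)
    · exact hf_lt v i (huv.1 rfl)
    · exact Set.singleton_ne_empty _ (Set.ssubset_singleton_iff.1 huv)

theorem isProperIntervalGraph_top {V : Type*} : IsProperIntervalGraph (⊤ : SimpleGraph V) :=
  ⟨fun _ => Set.Icc 0 0, ⟨fun _ => ⟨0, 0, le_rfl, rfl⟩, fun u v huv => by simpa using huv⟩,
    fun _ _ h => h.ne rfl⟩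

theorem exists_forall_inr_notMem_or_card_le {V : Type*} {m : ℕ} (F : Finset (Sym2 (V ⊕ Fin m))) :
    (∃ i, ∀ e ∈ F, Sum.inr i ∉ e) ∨ m ≤ 2 * F.card := by
  classical
  by_cases h : ∃ i, ∀ e ∈ F, Sum.inr i ∉ e
  · exact Or.inl h
  push Not at h
  right
  have hsub : (Finset.univ : Finset (Fin m)).map (Function.Embedding.inr : Fin m ↪ V ⊕ Fin m) ⊆
      F.biUnion fun e => e.toFinset := by
    intro x hx
    obtain ⟨i, -, rfl⟩ := Finset.mem_map.1 hx
    obtain ⟨e, he, hi⟩ := h i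
    exact Finset.mem_biUnion.2 ⟨e, he, Sym2.mem_toFinset.2 hi⟩
  have h1 := Finset.card_le_card hsub
  have h2 : (F.biUnion fun e => e.toFinset).card ≤ F.card * 2 :=
    Finset.card_biUnion_le_card_mul _ _ _ fun e _ => by
      by_cases he : e.IsDiag
      · simp [Sym2.card_toFinset_of_isDiag e he]
      · simp [Sym2.card_toFinset_of_not_isDiag e he]
  simp only [Finset.card_map, Finset.card_univ, Fintype.card_fin] at h1
  omega

/-- A graph on `n` vertices can be completed to a clique by adding at most `k` edges
as soon as `n ^ 2 ≤ 2 * k`. -/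
theorem exists_completion_of_card_sq_le {V : Type*} [Fintype V] (G : SimpleGraph V) {k : ℕ}
    (hk : Fintype.card V ^ 2 ≤ 2 * k) :
    ∃ F : Finset (Sym2 V), (∀ e ∈ F, ¬ e.IsDiag ∧ e ∉ G.edgeSet) ∧ F.card ≤ k ∧
      IsProperIntervalGraph (SimpleGraph.fromEdgeSet (G.edgeSet ∪ ↑F)) := by
  classical
  refine ⟨Gᶜ.edgeFinset, ?_, ?_, ?_⟩
  · intro e he
    induction e with | _ u v
    simpa using he
  · have h1 := Gᶜ.card_edgeFinset_le_card_choose_two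
    rw [Nat.choose_two_right] at h1
    have h2 : Fintype.card V * (Fintype.card V - 1) ≤ Fintype.card V ^ 2 := by
      rw [sq]
      exact Nat.mul_le_mul_left _ (Nat.sub_le _ _)
    omega
  · convert isProperIntervalGraph_top (V := V)
    ext u v
    simp only [SimpleGraph.fromEdgeSet_adj, SimpleGraph.coe_edgeFinset, Set.mem_union,
      SimpleGraph.mem_edgeSet, SimpleGraph.compl_adj, SimpleGraph.top_adj]
    tauto

/-- For `G'` obtained from `G` (with `n` vertices) by adding `n²`
isolated vertices: `G` can be made a proper interval graph by adding at most `k`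
non-edges iff `G'` can be made a proper Helly circular-arc graph by adding at
most `k` non-edges. -/
theorem completion_reduction {V : Type} [Fintype V] (G : SimpleGraph V) (k : ℕ) :
    (∃ F : Finset (Sym2 V), (∀ e ∈ F, ¬ e.IsDiag ∧ e ∉ G.edgeSet) ∧ F.card ≤ k ∧
        IsProperIntervalGraph (SimpleGraph.fromEdgeSet (G.edgeSet ∪ ↑F))) ↔
    (∃ F' : Finset (Sym2 (V ⊕ Fin (Fintype.card V ^ 2))),
        (∀ e ∈ F', ¬ e.IsDiag ∧
          e ∉ (G.map (Function.Embedding.inl : V ↪ V ⊕ Fin (Fintype.card V ^ 2))).edgeSet) ∧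
        F'.card ≤ k ∧
        IsProperHellyCircularArcGraph (SimpleGraph.fromEdgeSet
          ((G.map (Function.Embedding.inl : V ↪ V ⊕ Fin (Fintype.card V ^ 2))).edgeSet ∪
            ↑F'))) := by
  classical
  set ι : V ↪ V ⊕ Fin (Fintype.card V ^ 2) := Function.Embedding.inl
  constructor
  · rintro ⟨F, hF, hk, hI⟩
    refine ⟨F.map ι.sym2Map, ?_, by simpa using hk, ?_⟩
    · intro e' he'
      obtain ⟨e, he, rfl⟩ := Finset.mem_map.1 he'
      have h := hF e he
      induction e with | _ u v
      simpa [SimpleGraph.map_adj] using h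
    · convert (hI.map_inl (Fintype.card V ^ 2)).isProperHellyCircularArcGraph
      rw [SimpleGraph.edgeSet_map, Finset.coe_map, ← Set.image_union]
      ext x y
      simp only [SimpleGraph.fromEdgeSet_adj, SimpleGraph.map_adj]
      constructor
      · rintro ⟨⟨e, he, hxy⟩, hne⟩
        induction e with | _ u v
        rcases Sym2.eq_iff.1 (show s(ι u, ι v) = s(x, y) from hxy) with ⟨rfl, rfl⟩ | ⟨rfl, rfl⟩
        · exact ⟨u, v, ⟨he, fun h => hne (h ▸ rfl)⟩, rfl, rfl⟩
        · exact ⟨v, u, ⟨Sym2.eq_swap ▸ he, fun h => hne (h ▸ rfl)⟩, rfl, rfl⟩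
      · rintro ⟨u, v, ⟨he, hne⟩, rfl, rfl⟩
        exact ⟨⟨_, he, rfl⟩, ι.injective.ne hne⟩
  · rintro ⟨F', hF', hk, f, hf, hp, -⟩
    rcases exists_forall_inr_notMem_or_card_le F' with ⟨i, hi⟩ | hcard
    · refine ⟨F'.preimage ι.sym2Map ι.sym2Map.injective.injOn, ?_, ?_, ?_⟩
      · intro e he
        have h := hF' _ (Finset.mem_preimage.1 he)
        induction e with | _ u v
        simpa [SimpleGraph.map_adj, ι] using h
      · refine le_trans ?_ hk
        rw [← Finset.card_map ι.sym2Map]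
        exact Finset.card_le_card (Finset.map_subset_iff_subset_preimage.2 subset_rfl)
      · convert hf.isProperIntervalGraph_comap hp (w := Sum.inr i) ?_ ι (fun v => Sum.inl_ne_inr)
        · ext u v
          simp [SimpleGraph.map_adj, ι]
        · intro v hv
          rw [SimpleGraph.fromEdgeSet_adj] at hv
          rcases hv.1 with h | h
          · simp [SimpleGraph.map_adj, ι] at h
          · exact hi _ h (Sym2.mem_mk_left _ _)
    · exact exists_completion_of_card_sq_le G (hcard.trans (by omega))
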